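/- Translation of Paraconsistent Dependence Logic into non-dependence logic under Team Semantics: for every Paraconsistent Dependence Logic formula φ there exists a formula φ* of First Order Logic extended with non-dependence atoms ≠(t⃗₁, t⃗₂) interpreted in Team Semantics, such that for every model M, every team X with the free variables of φ in its domain, and every sign d ∈ {+, −}: (M, X) ⊨ₚᵈ φ if and only if (M, X) ⊭ᵈ φ*. (In fact φ* may be taken to be the formula obtained from ¬φ by replacing every dependence atom =(t⃗₁, t⃗₂) with ¬≠(t⃗₁, t⃗₂).) -/

import Mathlib

/-! ## Dependence Logic: syntax, Tarski semantics, Team Semantics,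
    Paraconsistent Team Semantics.

Variable assignments are total functions `ℕ → M.Dom`, so every team has
domain the set of all variables, and conditions like `Free(ψ) ⊆ Dom(X)`
hold automatically. The team `{∅}` consisting of the empty assignment is
represented by the singleton team of a fixed (arbitrary) assignment. -/

/-- A first-order signature: relation and function symbols with arities. -/
structure Signature : Type 1 where
  Rel : Type
  relArity : Rel → ℕ
  Func : Type
  funcArity : Func → ℕ

/-- First-order terms over a signature, with variables indexed by `ℕ`. -/
inductive Term (Sig : Signature) : Type where
  | var : ℕ → Term Sig
  | func : (f : Sig.Func) → (Fin (Sig.funcArity f) → Term Sig) → Term Sig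

/-- A first-order model for a signature (with nonempty domain). -/
structure Model (Sig : Signature) : Type 1 where
  Dom : Type
  nonempty : Nonempty Dom
  relInterp : (R : Sig.Rel) → (Fin (Sig.relArity R) → Dom) → Prop
  funcInterp : (f : Sig.Func) → (Fin (Sig.funcArity f) → Dom) → Dom

variable {Sig : Signature}

/-- Evaluation of a term under an assignment. -/
def Term.eval (M : Model Sig) (s : ℕ → M.Dom) : Term Sig → M.Dom
  | .var v => s v
  | .func f ts => M.funcInterp f (fun i => (ts i).eval M s)

/-- The set of variables occurring in a term. -/
def Term.vars : Term Sig → Set ℕ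
  | .var v => {v}
  | .func _ ts => ⋃ i, (ts i).vars

/-- Formulas of Dependence Logic: first-order atoms `R t⃗` and `t₁ = t₂`,
dependence atoms `=(t⃗₁, t⃗₂)`, negation, disjunction, existential
quantification. -/
inductive DLFormula (Sig : Signature) : Type where
  | rel : (R : Sig.Rel) → (Fin (Sig.relArity R) → Term Sig) → DLFormula Sig
  | eq : Term Sig → Term Sig → DLFormula Sig
  | dep : (n m : ℕ) → (Fin n → Term Sig) → (Fin m → Term Sig) → DLFormula Sig
  | neg : DLFormula Sig → DLFormula Sig
  | or : DLFormula Sig → DLFormula Sig → DLFormula Sig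
  | ex : ℕ → DLFormula Sig → DLFormula Sig

/-- `ψ ∧ θ` abbreviates `¬(¬ψ ∨ ¬θ)`. -/
def DLFormula.conj (ψ θ : DLFormula Sig) : DLFormula Sig := (ψ.neg.or θ.neg).neg

/-- `∀v ψ` abbreviates `¬∃v ¬ψ`. -/
def DLFormula.all (v : ℕ) (ψ : DLFormula Sig) : DLFormula Sig := ((ψ.neg).ex v).neg

/-- Free variables of a Dependence Logic formula. -/
def DLFormula.free : DLFormula Sig → Set ℕ
  | .rel _ ts => ⋃ i, (ts i).vars
  | .eq t₁ t₂ => t₁.vars ∪ t₂.vars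
  | .dep _ _ ts₁ ts₂ => (⋃ i, (ts₁ i).vars) ∪ ⋃ j, (ts₂ j).vars
  | .neg ψ => ψ.free
  | .or ψ θ => ψ.free ∪ θ.free
  | .ex v ψ => ψ.free \ {v}

/-- A formula is first-order if it contains no dependence atoms. -/
def DLFormula.IsFirstOrder : DLFormula Sig → Prop
  | .rel _ _ => True
  | .eq _ _ => True
  | .dep _ _ _ _ => False
  | .neg ψ => ψ.IsFirstOrder
  | .or ψ θ => ψ.IsFirstOrder ∧ θ.IsFirstOrder
  | .ex _ ψ => ψ.IsFirstOrder

/-- Tarski satisfaction `M ⊨_s ψ` (meaningful for first-order formulas;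
dependence atoms are given the trivial interpretation). -/
def Tarski (M : Model Sig) (s : ℕ → M.Dom) : DLFormula Sig → Prop
  | .rel R ts => M.relInterp R (fun i => (ts i).eval M s)
  | .eq t₁ t₂ => t₁.eval M s = t₂.eval M s
  | .dep _ _ _ _ => True
  | .neg ψ => ¬ Tarski M s ψ
  | .or ψ θ => Tarski M s ψ ∨ Tarski M s θ
  | .ex v ψ => ∃ m : M.Dom, Tarski M (Function.update s v m) ψ

/-- The team `X[F/v] = {s[m/v] : s ∈ X, m ∈ F(s)}`. -/
def teamSup {M : Model Sig} (X : Set (ℕ → M.Dom)) (v : ℕ)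
    (F : (ℕ → M.Dom) → Set M.Dom) : Set (ℕ → M.Dom) :=
  {s' | ∃ s ∈ X, ∃ m ∈ F s, s' = Function.update s v m}

/-- The team `X[M/v] = {s[m/v] : s ∈ X, m ∈ Dom(M)}`. -/
def teamSupAll {M : Model Sig} (X : Set (ℕ → M.Dom)) (v : ℕ) : Set (ℕ → M.Dom) :=
  {s' | ∃ s ∈ X, ∃ m : M.Dom, s' = Function.update s v m}

/-- Team Semantics: `TeamSat M true X ψ` is `(M,X) ⊨⁺ ψ` and
`TeamSat M false X ψ` is `(M,X) ⊨⁻ ψ`. -/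
def TeamSat (M : Model Sig) : Bool → Set (ℕ → M.Dom) → DLFormula Sig → Prop
  | true, X, .rel R ts => ∀ s ∈ X, M.relInterp R (fun i => (ts i).eval M s)
  | false, X, .rel R ts => ∀ s ∈ X, ¬ M.relInterp R (fun i => (ts i).eval M s)
  | true, X, .eq t₁ t₂ => ∀ s ∈ X, t₁.eval M s = t₂.eval M s
  | false, X, .eq t₁ t₂ => ∀ s ∈ X, t₁.eval M s ≠ t₂.eval M s
  | true, X, .dep _ _ ts₁ ts₂ => ∀ s ∈ X, ∀ s' ∈ X,
      (∀ i, (ts₁ i).eval M s = (ts₁ i).eval M s') →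
        ∀ j, (ts₂ j).eval M s = (ts₂ j).eval M s'
  | false, X, .dep _ _ _ _ => X = ∅
  | d, X, .neg ψ => TeamSat M (!d) X ψ
  | true, X, .or ψ θ => ∃ Y Z, X = Y ∪ Z ∧ TeamSat M true Y ψ ∧ TeamSat M true Z θ
  | false, X, .or ψ θ => TeamSat M false X ψ ∧ TeamSat M false X θ
  | true, X, .ex v ψ => ∃ F : (ℕ → M.Dom) → Set M.Dom,
      (∀ s ∈ X, (F s).Nonempty) ∧ TeamSat M true (teamSup X v F) ψ
  | false, X, .ex v ψ => TeamSat M false (teamSupAll X v) ψ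

/-- A fixed (arbitrary) assignment, playing the role of the empty assignment. -/
noncomputable def Model.defAsg (M : Model Sig) : ℕ → M.Dom :=
  fun _ => Classical.choice M.nonempty

/-- Truth/falsity of a sentence: `M ⊨ᵈ φ` iff `(M, {∅}) ⊨ᵈ φ`. -/
def Model.sat (M : Model Sig) (d : Bool) (φ : DLFormula Sig) : Prop :=
  TeamSat M d {M.defAsg} φ

/-- Paraconsistent Team Semantics: `(M,X) ⊨ₚᵈ ψ` iff `(M,X) ⊭^{d*} ψ`. -/
def PTeamSat (M : Model Sig) (d : Bool) (X : Set (ℕ → M.Dom))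
    (ψ : DLFormula Sig) : Prop :=
  ¬ TeamSat M (!d) X ψ

/-- Paraconsistent truth/falsity of a sentence. -/
def Model.psat (M : Model Sig) (d : Bool) (φ : DLFormula Sig) : Prop :=
  PTeamSat M d {M.defAsg} φ

/-! ### Statement 19: Paraconsistent Dependence Logic and
First Order Logic with non-dependence atoms. -/

/-- Formulas of Paraconsistent Dependence Logic: first-order atoms,
dependence atoms `=(t⃗₁, t⃗₂)`, negation, disjunction, existential
quantification. -/
inductive PDLFormula (Sig : Signature) : Type where
  | rel : (R : Sig.Rel) → (Fin (Sig.relArity R) → Term Sig) → PDLFormula Sig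
  | eq : Term Sig → Term Sig → PDLFormula Sig
  | dep : (n m : ℕ) → (Fin n → Term Sig) → (Fin m → Term Sig) → PDLFormula Sig
  | neg : PDLFormula Sig → PDLFormula Sig
  | or : PDLFormula Sig → PDLFormula Sig → PDLFormula Sig
  | ex : ℕ → PDLFormula Sig → PDLFormula Sig

/-- Compositional Paraconsistent Team Semantics for Paraconsistent Dependence
Logic: `PDT M true X φ` is `(M,X) ⊨ₚ⁺ φ` and `PDT M false X φ` is
`(M,X) ⊨ₚ⁻ φ`; the dependence atom is satisfied positively iff the functional
dependence holds, and negatively iff the team is nonempty. -/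
def PDT (M : Model Sig) : Bool → Set (ℕ → M.Dom) → PDLFormula Sig → Prop
  | true, X, .rel R ts => ∃ s ∈ X, M.relInterp R (fun i => (ts i).eval M s)
  | false, X, .rel R ts => ∃ s ∈ X, ¬ M.relInterp R (fun i => (ts i).eval M s)
  | true, X, .eq t₁ t₂ => ∃ s ∈ X, t₁.eval M s = t₂.eval M s
  | false, X, .eq t₁ t₂ => ∃ s ∈ X, t₁.eval M s ≠ t₂.eval M s
  | true, X, .dep _ _ ts₁ ts₂ => ∀ s ∈ X, ∀ s' ∈ X,
      (∀ i, (ts₁ i).eval M s = (ts₁ i).eval M s') →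
        ∀ j, (ts₂ j).eval M s = (ts₂ j).eval M s'
  | false, X, .dep _ _ _ _ => X ≠ ∅
  | d, X, .neg ψ => PDT M (!d) X ψ
  | true, X, .or ψ θ => PDT M true X ψ ∨ PDT M true X θ
  | false, X, .or ψ θ => ∀ Y Z, X = Y ∪ Z → PDT M false Y ψ ∨ PDT M false Z θ
  | true, X, .ex v ψ => PDT M true (teamSupAll X v) ψ
  | false, X, .ex v ψ => ∀ F : (ℕ → M.Dom) → Set M.Dom,
      (∀ s ∈ X, (F s).Nonempty) → PDT M false (teamSup X v F) ψ

/-- Formulas of First Order Logic extended with non-dependence atoms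
`≠(t⃗₁, t⃗₂)`. -/
inductive NDFormula (Sig : Signature) : Type where
  | rel : (R : Sig.Rel) → (Fin (Sig.relArity R) → Term Sig) → NDFormula Sig
  | eq : Term Sig → Term Sig → NDFormula Sig
  | ndep : (n m : ℕ) → (Fin n → Term Sig) → (Fin m → Term Sig) → NDFormula Sig
  | neg : NDFormula Sig → NDFormula Sig
  | or : NDFormula Sig → NDFormula Sig → NDFormula Sig
  | ex : ℕ → NDFormula Sig → NDFormula Sig

/-- Standard Team Semantics for First Order Logic with non-dependence atoms:
the non-dependence atom is satisfied positively iff two assignments in the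
team agree on `t⃗₁` but disagree on `t⃗₂`, and negatively iff the team is
empty. -/
def NDSat (M : Model Sig) : Bool → Set (ℕ → M.Dom) → NDFormula Sig → Prop
  | true, X, .rel R ts => ∀ s ∈ X, M.relInterp R (fun i => (ts i).eval M s)
  | false, X, .rel R ts => ∀ s ∈ X, ¬ M.relInterp R (fun i => (ts i).eval M s)
  | true, X, .eq t₁ t₂ => ∀ s ∈ X, t₁.eval M s = t₂.eval M s
  | false, X, .eq t₁ t₂ => ∀ s ∈ X, t₁.eval M s ≠ t₂.eval M s
  | true, X, .ndep _ _ ts₁ ts₂ => ∃ s ∈ X, ∃ s' ∈ X,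
      (∀ i, (ts₁ i).eval M s = (ts₁ i).eval M s') ∧
        ∃ j, (ts₂ j).eval M s ≠ (ts₂ j).eval M s'
  | false, X, .ndep _ _ _ _ => X = ∅
  | d, X, .neg ψ => NDSat M (!d) X ψ
  | true, X, .or ψ θ => ∃ Y Z, X = Y ∪ Z ∧ NDSat M true Y ψ ∧ NDSat M true Z θ
  | false, X, .or ψ θ => NDSat M false X ψ ∧ NDSat M false X θ
  | true, X, .ex v ψ => ∃ F : (ℕ → M.Dom) → Set M.Dom,
      (∀ s ∈ X, (F s).Nonempty) ∧ NDSat M true (teamSup X v F) ψ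
  | false, X, .ex v ψ => NDSat M false (teamSupAll X v) ψ

/-- Replace every dependence atom `=(t⃗₁, t⃗₂)` with `¬≠(t⃗₁, t⃗₂)`. -/
def PDLFormula.toND : PDLFormula Sig → NDFormula Sig
  | .rel R ts => .rel R ts
  | .eq t₁ t₂ => .eq t₁ t₂
  | .dep n m ts₁ ts₂ => .neg (.ndep n m ts₁ ts₂)
  | .neg ψ => .neg ψ.toND
  | .or ψ θ => .or ψ.toND θ.toND
  | .ex v ψ => .ex v ψ.toND

theorem PDT_iff_not_NDSat_toND (M : Model Sig) (φ : PDLFormula Sig)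
    (X : Set (ℕ → M.Dom)) (d : Bool) :
    PDT M d X φ ↔ ¬ NDSat M (!d) X φ.toND := by
  induction φ generalizing X d with
  | rel R ts => cases d <;> simp [PDT, NDSat, PDLFormula.toND]
  | eq t₁ t₂ => cases d <;> simp [PDT, NDSat, PDLFormula.toND]
  | dep n m ts₁ ts₂ => cases d <;> simp [PDT, NDSat, PDLFormula.toND]
  | neg ψ ih => cases d <;> simp [PDT, NDSat, PDLFormula.toND, ih]
  | or ψ θ ihψ ihθ =>
    cases d <;> simp [PDT, NDSat, PDLFormula.toND, ihψ, ihθ, imp_iff_not_or]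
  | ex v ψ ih => cases d <;> simp [PDT, NDSat, PDLFormula.toND, ih]

/-- every Paraconsistent Dependence Logic formula `φ` has a
translation `φ*` into First Order Logic with non-dependence atoms (under
standard Team Semantics) such that `(M,X) ⊨ₚᵈ φ` iff `(M,X) ⊭ᵈ φ*`. -/
theorem stmt19 (Sig : Signature) (φ : PDLFormula Sig) :
    ∃ φstar : NDFormula Sig,
      ∀ (M : Model Sig) (X : Set (ℕ → M.Dom)) (d : Bool),
        PDT M d X φ ↔ ¬ NDSat M d X φstar := by
  refine ⟨.neg φ.toND, fun M X d => ?_⟩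
  rw [PDT_iff_not_NDSat_toND]
  cases d <;> simp [NDSat]
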